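/- arXiv:2008.04592 — 2 statements merged into one kernel-verified Lean document; each statement's English description precedes it below -/
import Mathlib

section
/- Let n ≥ 3 be odd, k ≤ d, E ⊆ ℤ_n^d. If |E| ≫ √(τ(n))·n^{d + (k−1)/2} / γ(n)^{(d−1)/2}, then (1/|E|^k) ∑_{y¹,...,y^k ∈ E} |Δ_{y¹,...,y^k}(E)| ≫ n^k, where Δ_{y¹,...,y^k}(E) = {(‖x−y¹‖,...,‖x−y^k‖) : x ∈ E} ⊆ ℤ_n^k. -/
open Finset

noncomputable def chi (n : ℕ) (t : ZMod n) : ℂ :=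
  Complex.exp (2 * Real.pi * Complex.I * (t.val : ℂ) / (n : ℂ))

def dot {n d : ℕ} (x y : Fin d → ZMod n) : ZMod n := ∑ i, x i * y i

def nrm {n d : ℕ} (z : Fin d → ZMod n) : ZMod n := ∑ i, z i ^ 2

noncomputable def ft (n d : ℕ) [NeZero n] (f : (Fin d → ZMod n) → ℂ)
    (m : Fin d → ZMod n) : ℂ :=
  (n : ℂ)⁻¹ ^ d * ∑ x : Fin d → ZMod n, f x * chi n (-(dot x m))

/-- The number of ordered pairs of elements of `A` on which `f` takes the same value. -/
noncomputable def collisions {α β : Type*} [DecidableEq β] (A : Finset α) (f : α → β) : ℝ :=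
  ∑ x ∈ A, ∑ x' ∈ A, if f x = f x' then 1 else 0

section Collisions

variable {α β γ : Type*} [DecidableEq β] [DecidableEq γ]

lemma collisions_nonneg (A : Finset α) (f : α → β) : 0 ≤ collisions A f :=
  sum_nonneg fun _ _ => sum_nonneg fun _ _ => by split_ifs <;> norm_num

lemma collisions_prod_le (A : Finset α) (f : α → β) (g : α → γ) :
    collisions A (fun x => (f x, g x)) ≤ collisions A g := by
  unfold collisions
  gcongr with x hx x' hx'
  by_cases h : g x = g x'
  · simp only [Prod.mk.injEq, h, and_true, if_true]
    split_ifs <;> norm_num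
  · simp [h]

lemma sum_collisions_fiber (A : Finset α) (f : α → β) (g : α → γ) :
    ∑ t ∈ A.image f, collisions (A.filter fun x => f x = t) g =
      collisions A (fun x => (f x, g x)) := by
  unfold collisions
  rw [← sum_fiberwise_of_maps_to (g := f) (t := A.image f)
    (fun x hx => mem_image_of_mem f hx)]
  refine sum_congr rfl fun t _ => sum_congr rfl fun x hx => ?_
  rw [sum_filter]
  refine sum_congr rfl fun x' _ => ?_
  obtain rfl := (mem_filter.1 hx).2
  by_cases h : f x' = f x
  · simp [h]
  · simp [h, Ne.symm h]

lemma sum_card_fiber_sq (A : Finset α) (f : α → β) :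
    ∑ t ∈ A.image f, ((A.filter fun x => f x = t).card : ℝ) ^ 2 = collisions A f := by
  have h := sum_collisions_fiber A f (fun _ => ())
  have h2 : collisions A (fun x => (f x, ())) = collisions A f := by
    simp [collisions]
  rw [← h2, ← h]
  refine sum_congr rfl fun t _ => ?_
  simp [collisions, sq]

lemma card_sq_le_card_image_mul_collisions (A : Finset α) (f : α → β) :
    (A.card : ℝ) ^ 2 ≤ (A.image f).card * collisions A f := by
  rw [← sum_card_fiber_sq, card_eq_sum_card_image f A]
  push_cast
  exact sq_sum_le_card_mul_sum_sq

end Collisions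

section Fourier

variable {n : ℕ} [NeZero n] {α : Type*}

lemma norm_sq_sum_stdAddChar (A : Finset α) (f : α → ZMod n) :
    ((‖∑ x ∈ A, ZMod.stdAddChar (f x)‖ ^ 2 : ℝ) : ℂ) =
      ∑ x ∈ A, ∑ x' ∈ A, ZMod.stdAddChar (f x - f x') := by
  push_cast
  rw [← Complex.mul_conj', map_sum, sum_mul_sum]
  refine sum_congr rfl fun x _ => sum_congr rfl fun x' _ => ?_
  rw [← AddChar.map_neg_eq_conj, ← AddChar.map_add_eq_mul, sub_eq_add_neg]

lemma mul_collisions_eq_sum_norm_sq (A : Finset α) (f : α → ZMod n) :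
    n * collisions A f =
      ∑ s : ZMod n, ‖∑ x ∈ A, (ZMod.stdAddChar (s * f x) : ℂ)‖ ^ 2 := by
  apply Complex.ofReal_injective
  rw [Complex.ofReal_sum]
  simp_rw [norm_sq_sum_stdAddChar, ← mul_sub]
  rw [sum_comm]
  simp_rw [sum_comm (s := univ) (t := A),
    AddChar.sum_mulShift _ (ZMod.isPrimitive_stdAddChar n), sub_eq_zero, ZMod.card]
  simp only [collisions, mul_sum, Complex.ofReal_sum, mul_ite, mul_one, mul_zero]
  refine sum_congr rfl fun x _ => sum_congr rfl fun x' _ => ?_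
  split_ifs <;> simp

lemma sum_stdAddChar_dot {d : ℕ} (b : Fin d → ZMod n) :
    ∑ y : Fin d → ZMod n, (ZMod.stdAddChar (∑ i, y i * b i) : ℂ) =
      if b = 0 then (n : ℂ) ^ d else 0 := by
  have h (y : Fin d → ZMod n) : (ZMod.stdAddChar (∑ i, y i * b i) : ℂ) =
      ∏ i, ZMod.stdAddChar (y i * b i) := 
    map_prod (ZMod.stdAddChar (N := n)).toMonoidHom
      (fun i => Multiplicative.ofAdd (y i * b i)) univ
  simp_rw [h]
  rw [← Fintype.piFinset_univ, ← prod_univ_sum (fun _ => univ)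
    (fun i z => (ZMod.stdAddChar (z * b i) : ℂ))]
  simp_rw [AddChar.sum_mulShift _ (ZMod.isPrimitive_stdAddChar n), ZMod.card]
  push_cast
  rw [prod_ite_zero]
  simp [funext_iff]

lemma sum_norm_sq_le_collisions {d : ℕ} (A : Finset α) (b : α → Fin d → ZMod n)
    (c : α → ZMod n) (e : (Fin d → ZMod n) → ZMod n) :
    ∑ y : Fin d → ZMod n,
      ‖∑ x ∈ A, (ZMod.stdAddChar (c x + e y + ∑ i, y i * b x i) : ℂ)‖ ^ 2 ≤
        (n : ℝ) ^ d * collisions A b := by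
  have key : ((∑ y : Fin d → ZMod n,
      ‖∑ x ∈ A, (ZMod.stdAddChar (c x + e y + ∑ i, y i * b x i) : ℂ)‖ ^ 2 : ℝ) : ℂ) =
      ∑ x ∈ A, ∑ x' ∈ A,
        ZMod.stdAddChar (c x - c x') * if b x = b x' then (n : ℂ) ^ d else 0 := by
    rw [Complex.ofReal_sum]
    simp_rw [norm_sq_sum_stdAddChar]
    rw [sum_comm]
    refine sum_congr rfl fun x _ => ?_
    rw [sum_comm]
    refine sum_congr rfl fun x' _ => ?_
    simp_rw [← sub_eq_zero (a := b x) (b := b x')]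
    rw [← sum_stdAddChar_dot, mul_sum]
    refine sum_congr rfl fun y _ => ?_
    rw [← AddChar.map_add_eq_mul]
    congr 1
    simp only [Pi.sub_apply, mul_sub, sum_sub_distrib]
    ring
  rw [← Complex.norm_of_nonneg (sum_nonneg fun _ _ => sq_nonneg _), key]
  refine (norm_sum_le _ _).trans ?_
  rw [collisions, mul_sum]
  refine sum_le_sum fun x _ => (norm_sum_le _ _).trans ?_
  rw [mul_sum]
  refine sum_le_sum fun x' _ => ?_
  rw [norm_mul, AddChar.norm_apply, one_mul]
  split_ifs <;> simp

end Fourier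

section Annihilators

variable {n : ℕ} [NeZero n]

lemma card_mul_eq_zero_le_gcd (s : ZMod n) :
    (univ.filter fun z : ZMod n => s * z = 0).card ≤ s.val.gcd n := by
  refine le_trans (card_le_card fun z hz => ?_)
    (IsAddCyclic.card_nsmul_eq_zero_le (α := ZMod n) (Nat.gcd_pos_of_pos_right _ (NeZero.pos n)))
  simp only [mem_filter, mem_univ, true_and] at hz ⊢
  have := congrArg (Int.cast : ℤ → ZMod n) (Nat.gcd_eq_gcd_ab s.val n)
  push_cast at this
  rw [nsmul_eq_mul, this]
  simp only [ZMod.natCast_val, ZMod.cast_id', id, CharP.cast_eq_zero]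
  linear_combination (s.val.gcdA n : ZMod n) * hz

lemma card_dvd_val_le {g : ℕ} (hg : g ∣ n) :
    (univ.filter fun s : ZMod n => g ∣ s.val).card ≤ n / g := by
  refine le_trans (card_le_card fun z hz => ?_)
    (IsAddCyclic.card_nsmul_eq_zero_le (α := ZMod n)
      (Nat.div_pos_iff.2 ⟨Nat.pos_of_dvd_of_pos hg (NeZero.pos n),
        Nat.le_of_dvd (NeZero.pos n) hg⟩))
  simp only [mem_filter, mem_univ, true_and] at hz ⊢
  obtain ⟨m, hm⟩ := hz
  rw [← ZMod.natCast_zmod_val z, hm, nsmul_eq_mul, ← Nat.cast_mul, ← mul_assoc,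
    Nat.div_mul_cancel hg]
  simp

lemma sum_gcd_val_le : ∑ s : ZMod n, s.val.gcd n ≤ n * n.divisors.card := by
  calc ∑ s : ZMod n, s.val.gcd n
      ≤ ∑ s : ZMod n, ∑ g ∈ n.divisors, if g ∣ s.val then g else 0 := by
        refine sum_le_sum fun s _ => ?_
        have hmem : s.val.gcd n ∈ n.divisors :=
          Nat.mem_divisors.2 ⟨Nat.gcd_dvd_right _ _, NeZero.ne n⟩
        refine le_trans ?_ (single_le_sum
          (f := fun g => if g ∣ s.val then g else 0) (fun _ _ => Nat.zero_le _) hmem)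
        rw [if_pos (Nat.gcd_dvd_left _ _)]
    _ = ∑ g ∈ n.divisors, (univ.filter fun s : ZMod n => g ∣ s.val).card * g := by
        rw [sum_comm]
        refine sum_congr rfl fun g _ => ?_
        rw [← sum_filter, sum_const, smul_eq_mul]
    _ ≤ ∑ _g ∈ n.divisors, n := by
        refine sum_le_sum fun g hg => ?_
        have hg' := Nat.dvd_of_mem_divisors hg
        exact (Nat.mul_le_mul_right g (card_dvd_val_le hg')).trans (Nat.div_mul_cancel hg').le
    _ = n * n.divisors.card := by simp [mul_comm]

lemma gcd_val_mul_minFac_le {s : ZMod n} (hs : s ≠ 0) : s.val.gcd n * n.minFac ≤ n := by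
  obtain ⟨m, hm⟩ := Nat.gcd_dvd_right s.val n
  have hm1 : m ≠ 1 := by
    rintro rfl
    rw [mul_one] at hm
    have hdvd : n ∣ s.val := hm.dvd.trans (Nat.gcd_dvd_left s.val n)
    exact hs ((ZMod.val_eq_zero s).1 (Nat.eq_zero_of_dvd_of_lt hdvd s.val_lt))
  have hmpos : 0 < m := Nat.pos_of_ne_zero (by rintro rfl; exact NeZero.ne n (by simpa using hm))
  have hle : n.minFac ≤ m := Nat.minFac_le_of_dvd (by omega) (Dvd.intro_left _ hm.symm)
  calc s.val.gcd n * n.minFac ≤ s.val.gcd n * m := Nat.mul_le_mul_left _ hle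
    _ = n := hm.symm

lemma collisions_mul_le {d : ℕ} (E : Finset (Fin d → ZMod n)) (s : ZMod n) :
    collisions E (fun x i => s * x i) ≤ E.card * (s.val.gcd n : ℝ) ^ d := by
  rw [collisions, ← nsmul_eq_mul]
  refine sum_le_card_nsmul _ _ _ fun x _ => ?_
  rw [sum_boole]
  have hsub : (E.filter fun x' => (fun i => s * x i) = fun i => s * x' i).card ≤
      (Fintype.piFinset fun _ : Fin d => univ.filter fun z : ZMod n => s * z = 0).card := by
    refine card_le_card_of_injOn (fun x' => x - x') (fun x' hx' => ?_)
      (sub_right_injective.injOn)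
    simp only [coe_filter, Set.mem_ofPred_eq, funext_iff] at hx'
    simp [mul_sub, hx'.2]
  rw [Fintype.card_piFinset_const] at hsub
  exact_mod_cast hsub.trans (Nat.pow_le_pow_left (card_mul_eq_zero_le_gcd s) d)

lemma sum_collisions_mul_le {d : ℕ} (hd : 1 ≤ d) (E : Finset (Fin d → ZMod n)) :
    ∑ s ∈ univ.erase (0 : ZMod n), collisions E (fun x i => s * x i) ≤
      E.card * ((n : ℝ) / n.minFac) ^ (d - 1) * (n * n.divisors.card) := by
  have hγ : (0 : ℝ) < n.minFac := by exact_mod_cast Nat.minFac_pos n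
  calc _ ≤ ∑ s ∈ univ.erase (0 : ZMod n),
          E.card * ((n : ℝ) / n.minFac) ^ (d - 1) * (s.val.gcd n : ℝ) := by
        refine sum_le_sum fun s hs => (collisions_mul_le E s).trans ?_
        rw [mul_assoc]
        obtain ⟨e, rfl⟩ := Nat.exists_eq_add_of_le' hd
        rw [pow_succ, Nat.add_sub_cancel]
        gcongr
        rw [le_div_iff₀ hγ]
        exact_mod_cast gcd_val_mul_minFac_le (ne_of_mem_erase hs)
    _ = E.card * ((n : ℝ) / n.minFac) ^ (d - 1) *
          ∑ s ∈ univ.erase (0 : ZMod n), (s.val.gcd n : ℝ) := by rw [mul_sum]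
    _ ≤ _ := by
        gcongr
        refine (sum_le_sum_of_subset_of_nonneg (erase_subset _ _)
          fun _ _ _ => Nat.cast_nonneg _).trans ?_
        exact_mod_cast sum_gcd_val_le (n := n)

end Annihilators

section Energy

variable {n d : ℕ}

/-- The number of triples `(x, x', y)` with `x, x' ∈ E`, `y ∈ E ^ k`, such that `x` and `x'` are
at the same distances from all the `y i`. -/
noncomputable def starEnergy (k : ℕ) (E : Finset (Fin d → ZMod n)) : ℝ :=
  ∑ y ∈ Fintype.piFinset (fun _ : Fin k => E),
    collisions E (fun x => fun i : Fin k => nrm (x - y i))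

lemma sum_ite_forall_eq_pow (k : ℕ) (E : Finset (Fin d → ZMod n)) (x x' : Fin d → ZMod n) :
    ∑ y ∈ Fintype.piFinset (fun _ : Fin k => E),
      (if (fun i => nrm (x - y i)) = (fun i => nrm (x' - y i)) then (1 : ℝ) else 0) =
    (∑ y ∈ E, if nrm (x - y) = nrm (x' - y) then (1 : ℝ) else 0) ^ k := by
  rw [sum_pow']
  refine sum_congr rfl fun y _ => ?_
  rw [prod_ite_zero]
  simp [funext_iff]

lemma starEnergy_eq (k : ℕ) (E : Finset (Fin d → ZMod n)) :
    starEnergy k E = ∑ x ∈ E, ∑ x' ∈ E,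
      (∑ y ∈ E, if nrm (x - y) = nrm (x' - y) then (1 : ℝ) else 0) ^ k := by
  simp only [starEnergy, collisions]
  rw [sum_comm]
  refine sum_congr rfl fun x _ => ?_
  rw [sum_comm]
  exact sum_congr rfl fun x' _ => sum_ite_forall_eq_pow k E x x'

lemma starEnergy_succ (k : ℕ) (E : Finset (Fin d → ZMod n)) :
    starEnergy (k + 1) E = ∑ y ∈ Fintype.piFinset (fun _ : Fin k => E), ∑ z ∈ E,
      collisions E (fun x => ((fun i : Fin k => nrm (x - y i)), nrm (x - z))) := by
  simp only [starEnergy_eq, collisions, pow_succ, ← sum_ite_forall_eq_pow, sum_mul_sum]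
  have h (y : Fin k → Fin d → ZMod n) : ∑ z ∈ E, ∑ x ∈ E, ∑ x' ∈ E,
      (if ((fun i => nrm (x - y i)), nrm (x - z)) = ((fun i => nrm (x' - y i)), nrm (x' - z))
        then (1 : ℝ) else 0) = ∑ x ∈ E, ∑ x' ∈ E, ∑ z ∈ E,
      (if (fun i => nrm (x - y i)) = (fun i => nrm (x' - y i)) then (1 : ℝ) else 0) *
        if nrm (x - z) = nrm (x' - z) then (1 : ℝ) else 0 := by
    rw [sum_comm]
    refine sum_congr rfl fun x _ => ?_
    rw [sum_comm]
    simp only [Prod.mk.injEq, ite_and, ite_mul, one_mul, zero_mul]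
  simp only [h]
  rw [sum_comm]
  conv_rhs => rw [sum_comm]
  rw [sum_comm]
  refine sum_congr rfl fun x _ => ?_
  rw [sum_comm]

lemma card_pow_sq_le_mul_starEnergy (k : ℕ) (E : Finset (Fin d → ZMod n)) :
    ((E.card : ℝ) ^ (k + 1)) ^ 2 ≤
      (∑ y ∈ Fintype.piFinset (fun _ : Fin k => E),
          ((E.image (fun x => fun i : Fin k => nrm (x - y i))).card : ℝ)) *
        starEnergy k E := by
  have h := sum_sq_le_sum_mul_sum_of_sq_le_mul (Fintype.piFinset (fun _ : Fin k => E))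
    (r := fun _ => (E.card : ℝ)) (fun y _ => Nat.cast_nonneg _)
    (fun y _ => collisions_nonneg E _)
    (fun y _ => card_sq_le_card_image_mul_collisions E
      (fun x => fun i : Fin k => nrm (x - y i)))
  rw [sum_const, Fintype.card_piFinset_const, nsmul_eq_mul, Nat.cast_pow, ← pow_succ] at h
  exact h

variable [NeZero n]

lemma mul_sum_collisions_nrm_le (hn : Odd n) (E A : Finset (Fin d → ZMod n)) :
    n * ∑ y ∈ E, collisions A (fun x => nrm (x - y)) ≤
      E.card * (A.card : ℝ) ^ 2 +
        (n : ℝ) ^ d * ∑ s ∈ univ.erase (0 : ZMod n), collisions A (fun x i => s * x i) := by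
  have h2 : IsUnit (2 : ZMod n) := by
    have := (ZMod.isUnit_iff_coprime 2 n).2 (Nat.coprime_two_left.2 hn)
    exact_mod_cast this
  have hcoll (s : ZMod n) :
      collisions A (fun x i => -2 * (s * x i)) = collisions A (fun x i => s * x i) := by
    unfold collisions
    refine sum_congr rfl fun x _ => sum_congr rfl fun x' _ => if_congr ?_ rfl rfl
    simp only [funext_iff, h2.neg.mul_right_inj]
  rw [mul_sum]
  simp_rw [mul_collisions_eq_sum_norm_sq]
  rw [sum_comm, ← add_sum_erase _ _ (mem_univ (0 : ZMod n)), mul_sum]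
  refine add_le_add (by simp) (sum_le_sum fun s _ => ?_)
  rw [← hcoll]
  refine le_trans ?_ (sum_norm_sq_le_collisions A (fun x i => -2 * (s * x i))
    (fun x => s * nrm x) (fun y => s * nrm y))
  refine (sum_le_sum_of_subset_of_nonneg (subset_univ E) fun _ _ _ => sq_nonneg _).trans_eq ?_
  refine sum_congr rfl fun y _ => ?_
  congr 2
  refine sum_congr rfl fun x _ => ?_
  congr 1
  simp only [nrm, Pi.sub_apply, mul_sum, ← sum_add_distrib]
  refine sum_congr rfl fun i _ => ?_
  ring

lemma mul_sum_collisions_pair_le {β : Type*} [DecidableEq β] (hn : Odd n) (hd : 1 ≤ d)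
    (E : Finset (Fin d → ZMod n)) (f : (Fin d → ZMod n) → β) :
    n * ∑ y ∈ E, collisions E (fun x => (f x, nrm (x - y))) ≤
      E.card * collisions E f + (n : ℝ) ^ d *
        (E.card * ((n : ℝ) / n.minFac) ^ (d - 1) * (n * n.divisors.card)) := by
  have h := sum_le_sum fun t (_ : t ∈ E.image f) =>
    mul_sum_collisions_nrm_le hn E (E.filter fun x => f x = t)
  simp only [sum_add_distrib, ← mul_sum, sum_card_fiber_sq] at h
  rw [sum_comm, sum_comm (s := E.image f) (t := univ.erase (0 : ZMod n))] at h
  simp only [sum_collisions_fiber] at h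
  refine h.trans ?_
  gcongr
  exact (sum_le_sum fun s _ => collisions_prod_le E f _).trans (sum_collisions_mul_le hd E)

lemma starEnergy_le (hn : Odd n) (hd : 1 ≤ d) (k : ℕ) (E : Finset (Fin d → ZMod n)) :
    starEnergy k E ≤ (E.card : ℝ) ^ (k + 2) / n ^ k + k * ((E.card : ℝ) ^ k *
      ((n : ℝ) ^ d * (((n : ℝ) / n.minFac) ^ (d - 1) * n.divisors.card))) := by
  have hn0 : (1 : ℝ) ≤ n := by exact_mod_cast NeZero.one_le (n := n)
  set D : ℝ := (n : ℝ) ^ d * (((n : ℝ) / n.minFac) ^ (d - 1) * n.divisors.card) with hD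
  have hD0 : 0 ≤ D := by positivity
  induction k with
  | zero => simp [starEnergy_eq, sq]
  | succ k ih =>
    have hstep : n * starEnergy (k + 1) E ≤
        E.card * starEnergy k E + E.card ^ k * (E.card * n * D) := by
      rw [starEnergy_succ, starEnergy, mul_sum, mul_sum]
      refine (sum_le_sum fun y _ => mul_sum_collisions_pair_le hn hd E _).trans_eq ?_
      rw [sum_add_distrib, sum_const, Fintype.card_piFinset_const, nsmul_eq_mul, hD]
      push_cast
      ring
    have hmono : (k : ℝ) * (E.card : ℝ) ^ (k + 1) * D ≤
        n * (k * (E.card : ℝ) ^ (k + 1) * D) :=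
      le_mul_of_one_le_left (by positivity) hn0
    refine le_of_mul_le_mul_left ?_ (zero_lt_one.trans_le hn0)
    calc n * starEnergy (k + 1) E
        ≤ E.card * (E.card ^ (k + 2) / n ^ k + k * (E.card ^ k * D)) +
            E.card ^ k * (E.card * n * D) := by
          refine hstep.trans ?_
          gcongr
      _ = (E.card : ℝ) ^ (k + 3) / n ^ k + k * (E.card : ℝ) ^ (k + 1) * D +
            n * (E.card ^ (k + 1) * D) := by ring
      _ ≤ (E.card : ℝ) ^ (k + 3) / n ^ k + n * (k * (E.card : ℝ) ^ (k + 1) * D) +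
            n * (E.card ^ (k + 1) * D) := by gcongr
      _ = n * (E.card ^ (k + 1 + 2) / n ^ (k + 1) +
            (k + 1 : ℕ) * (E.card ^ (k + 1) * D)) := by
          push_cast
          field_simp
          ring

end Energy

theorem stmt12 (k d : ℕ) (hk : 1 ≤ k) (hkd : k ≤ d) :
    ∃ C > (0 : ℝ), ∃ c > (0 : ℝ), ∀ (n : ℕ) [NeZero n], Odd n → 3 ≤ n →
      ∀ E : Finset (Fin d → ZMod n),
      (E.card : ℝ) ≥ C * Real.sqrt (n.divisors.card) *
          (n : ℝ) ^ ((d : ℝ) + ((k : ℝ) - 1) / 2) /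
          (n.minFac : ℝ) ^ (((d : ℝ) - 1) / 2) →
      (1 / (E.card : ℝ) ^ k) *
        ∑ y ∈ Fintype.piFinset (fun _ : Fin k => E),
          ((E.image (fun x => fun i : Fin k => nrm (x - y i))).card : ℝ)
        ≥ c * (n : ℝ) ^ k := by
  refine ⟨1, one_pos, 1 / (k + 1), by positivity, fun n _ hodd _ E hE => ?_⟩
  have hd : 1 ≤ d := hk.trans hkd
  have hn : (0 : ℝ) < n := by exact_mod_cast NeZero.pos n
  have hγ : (0 : ℝ) < n.minFac := by exact_mod_cast Nat.minFac_pos n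
  have hτ : (0 : ℝ) < n.divisors.card := by
    exact_mod_cast card_pos.2 (Nat.nonempty_divisors.2 (NeZero.ne n))
  set S := ∑ y ∈ Fintype.piFinset (fun _ : Fin k => E),
    ((E.image (fun x => fun i : Fin k => nrm (x - y i))).card : ℝ) with hS
  have hpos : (0 : ℝ) < E.card := lt_of_lt_of_le (by positivity) hE
  have hsq : (n.divisors.card : ℝ) * (n : ℝ) ^ (2 * d + (k - 1)) / (n.minFac : ℝ) ^ (d - 1) ≤
      (E.card : ℝ) ^ 2 := by
    refine le_trans (le_of_eq ?_) (pow_le_pow_left₀ (by positivity) hE 2)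
    rw [one_mul, div_pow, mul_pow, Real.sq_sqrt hτ.le, ← Real.rpow_mul_natCast hn.le,
      ← Real.rpow_mul_natCast hγ.le, ← Real.rpow_natCast, ← Real.rpow_natCast]
    push_cast [Nat.cast_sub hk, Nat.cast_sub hd]
    ring_nf
  have hterm : (E.card : ℝ) ^ k *
      ((n : ℝ) ^ d * (((n : ℝ) / n.minFac) ^ (d - 1) * n.divisors.card)) ≤
      (E.card : ℝ) ^ (k + 2) / n ^ k := by
    rw [pow_add, mul_div_assoc]
    gcongr
    rw [le_div_iff₀ (by positivity)]
    refine le_trans (le_of_eq ?_) hsq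
    obtain ⟨a, rfl⟩ := Nat.exists_eq_add_of_le' hk
    obtain ⟨b, rfl⟩ := Nat.exists_eq_add_of_le' hd
    simp only [Nat.add_sub_cancel, div_pow]
    field_simp
    ring
  have hM : starEnergy k E ≤ (k + 1) * ((E.card : ℝ) ^ (k + 2) / n ^ k) := by
    refine (starEnergy_le hodd hd k E).trans ?_
    rw [add_mul, one_mul, add_comm]
    gcongr
  have hS0 : 0 ≤ S := sum_nonneg fun _ _ => Nat.cast_nonneg _
  have hCS := (card_pow_sq_le_mul_starEnergy k E).trans (mul_le_mul_of_nonneg_left hM hS0)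
  have hmain : (n : ℝ) ^ k * E.card ^ k ≤ S * (k + 1) := by
    refine le_of_mul_le_mul_right ?_ (show (0 : ℝ) < E.card ^ (k + 2) / n ^ k by positivity)
    calc (n : ℝ) ^ k * E.card ^ k * (E.card ^ (k + 2) / n ^ k)
        = ((E.card : ℝ) ^ (k + 1)) ^ 2 := by field_simp; ring
      _ ≤ _ := by rw [mul_assoc]; exact hCS
  rw [ge_iff_le, one_div_mul_eq_div, one_div_mul_eq_div, div_le_div_iff₀ (by positivity)
    (by positivity)]
  exact hmain
end

section
/- Let n ≥ 3 be odd, 1 ≤ k ≤ d, E ⊆ ℤ_n^d. If |E| ≫ √(τ(n))·n^{d + (k−1)/2} / γ(n)^{(d−1)/2}, then the set of distance k-simplices determined by E has size |T_k(E)| ≫ n^{k(k+1)/2}. -/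
open Finset

section Schur

variable {X W : Type*} [Fintype X] [Fintype W]

theorem sum_sq_le_of_gram_row_le (K : X → W → ℝ) {A : ℝ}
    (hA : ∀ w, ∑ w', |∑ x, K x w * K x w'| ≤ A) (g : W → ℝ) :
    ∑ x, (∑ w, g w * K x w) ^ 2 ≤ A * ∑ w, g w ^ 2 := by
  set M : W → W → ℝ := fun w w' => ∑ x, K x w * K x w' with hM
  have hsymm : ∀ w w', M w w' = M w' w := fun w w' => by simp only [hM, mul_comm]
  have h1 : ∑ x, (∑ w, g w * K x w) ^ 2 = ∑ w, ∑ w', g w * g w' * M w w' := by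
    have h0 : ∀ x, (∑ w, g w * K x w) ^ 2 = ∑ w, ∑ w', g w * g w' * (K x w * K x w') := fun x => by
      rw [sq, sum_mul_sum]
      exact sum_congr rfl fun w _ => sum_congr rfl fun w' _ => by ring
    simp only [h0, hM, mul_sum]
    rw [sum_comm]
    exact sum_congr rfl fun w _ => sum_comm
  have h2 : ∀ w w', g w * g w' * M w w' ≤ g w ^ 2 / 2 * |M w w'| + g w' ^ 2 / 2 * |M w w'| := by
    intro w w'
    have h3 : |g w * g w'| ≤ g w ^ 2 / 2 + g w' ^ 2 / 2 := by
      rw [abs_le]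
      constructor <;> nlinarith [sq_nonneg (g w + g w'), sq_nonneg (g w - g w')]
    calc g w * g w' * M w w' ≤ |g w * g w'| * |M w w'| := by
          rw [← abs_mul]; exact le_abs_self _
      _ ≤ (g w ^ 2 / 2 + g w' ^ 2 / 2) * |M w w'| := by gcongr
      _ = _ := by ring
  have h4 : ∑ w, ∑ w', g w' ^ 2 / 2 * |M w w'| = ∑ w, ∑ w', g w ^ 2 / 2 * |M w w'| := by
    rw [sum_comm]
    exact sum_congr rfl fun w _ => sum_congr rfl fun w' _ => by rw [hsymm]
  calc ∑ x, (∑ w, g w * K x w) ^ 2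
      ≤ ∑ w, ∑ w', (g w ^ 2 / 2 * |M w w'| + g w' ^ 2 / 2 * |M w w'|) := by
        rw [h1]; exact sum_le_sum fun w _ => sum_le_sum fun w' _ => h2 w w'
    _ = ∑ w, g w ^ 2 * ∑ w', |M w w'| := by
        simp only [sum_add_distrib]
        rw [h4, ← sum_add_distrib]
        refine sum_congr rfl fun w _ => ?_
        rw [← mul_sum]; ring
    _ ≤ ∑ w, g w ^ 2 * A := sum_le_sum fun w _ => by gcongr; exact hA w
    _ = A * ∑ w, g w ^ 2 := by rw [← sum_mul, mul_comm]

theorem sum_sq_le_of_gram_row_le_dual (K : X → W → ℝ) {A : ℝ} (hA0 : 0 ≤ A)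
    (hA : ∀ w, ∑ w', |∑ x, K x w * K x w'| ≤ A) (f : X → ℝ) :
    ∑ w, (∑ x, f x * K x w) ^ 2 ≤ A * ∑ x, f x ^ 2 := by
  set r : W → ℝ := fun w => ∑ x, f x * K x w with hr
  set S : ℝ := ∑ w, r w ^ 2 with hS
  have h1 : S = ∑ x, f x * ∑ w, r w * K x w := by
    simp only [hS, mul_sum]
    rw [sum_comm]
    refine sum_congr rfl fun w _ => ?_
    rw [sq]
    nth_rewrite 2 [hr]
    rw [mul_sum]
    exact sum_congr rfl fun x _ => by ring
  have h2 : S ^ 2 ≤ (∑ x, f x ^ 2) * (A * S) := by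
    calc S ^ 2 = (∑ x, f x * ∑ w, r w * K x w) ^ 2 := by rw [← h1]
      _ ≤ (∑ x, f x ^ 2) * ∑ x, (∑ w, r w * K x w) ^ 2 := sum_mul_sq_le_sq_mul_sq _ _ _
      _ ≤ _ := by
        gcongr
        exact sum_sq_le_of_gram_row_le K hA r
  have hf : 0 ≤ ∑ x, f x ^ 2 := sum_nonneg fun x _ => sq_nonneg _
  rcases (sum_nonneg fun w _ => sq_nonneg (r w) : 0 ≤ S).eq_or_lt with h0 | h0
  · rw [hS, ← h0]; positivity
  · have : S * S ≤ (A * ∑ x, f x ^ 2) * S := by nlinarith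
    exact le_of_mul_le_mul_right this h0

end Schur

section Characters

variable {n : ℕ} [NeZero n]

theorem sum_stdAddChar_mul (b : ZMod n) :
    ∑ s : ZMod n, (ZMod.stdAddChar (s * b) : ℂ) = if b = 0 then (n : ℂ) else 0 := by
  rw [AddChar.sum_mulShift b (ZMod.isPrimitive_stdAddChar n)]
  simp [ZMod.card]

theorem sum_stdAddChar_dotProduct {ι : Type*} [Fintype ι] [DecidableEq ι] (v : ι → ZMod n) :
    ∑ x : ι → ZMod n, (ZMod.stdAddChar (x ⬝ᵥ v) : ℂ) =
      if v = 0 then (n : ℂ) ^ Fintype.card ι else 0 := by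
  have h : ∀ x : ι → ZMod n, (ZMod.stdAddChar (x ⬝ᵥ v) : ℂ) =
      ∏ i, (ZMod.stdAddChar (x i * v i) : ℂ) := fun x => by
    rw [dotProduct]
    exact map_sum (ZMod.stdAddChar (N := n)).toAddMonoidHom _ _
  simp only [h]
  have h2 := (prod_univ_sum (fun _ : ι => (univ : Finset (ZMod n)))
    (fun i s => (ZMod.stdAddChar (s * v i) : ℂ))).symm
  rw [Fintype.piFinset_univ] at h2
  rw [h2]
  simp only [sum_stdAddChar_mul]
  split_ifs with hv
  · simp [hv]
  · obtain ⟨i, hi⟩ := Function.ne_iff.mp hv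
    exact prod_eq_zero (mem_univ i) (if_neg hi)

variable {ι W : Type*} [Fintype ι]

/-- The incidence kernel of the affine hyperplanes `x ⬝ᵥ φ w = c w`, minus its density. -/
noncomputable def planeKernel (φ : W → ι → ZMod n) (c : W → ZMod n) (x : ι → ZMod n) (w : W) : ℝ :=
  (if x ⬝ᵥ φ w = c w then 1 else 0) - (n : ℝ)⁻¹

theorem planeKernel_eq_sum (φ : W → ι → ZMod n) (c : W → ZMod n) (x : ι → ZMod n) (w : W) :
    (planeKernel φ c x w : ℂ) =
      (n : ℂ)⁻¹ * ∑ s ∈ univ.erase (0 : ZMod n), ZMod.stdAddChar (s * (x ⬝ᵥ φ w - c w)) := by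
  have hn : (n : ℂ) ≠ 0 := by exact_mod_cast NeZero.ne n
  have h := sum_stdAddChar_mul (x ⬝ᵥ φ w - c w)
  rw [← add_sum_erase _ _ (mem_univ (0 : ZMod n)), zero_mul, AddChar.map_zero_eq_one] at h
  rw [eq_sub_of_add_eq' h, planeKernel]
  by_cases hx : x ⬝ᵥ φ w = c w
  · simp [hx]; field_simp
  · simp [hx, sub_eq_zero]

theorem abs_gram_planeKernel_le [DecidableEq ι] (φ : W → ι → ZMod n) (c : W → ZMod n) (w w' : W) :
    |∑ x, planeKernel φ c x w * planeKernel φ c x w'| ≤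
      (n : ℝ)⁻¹ ^ 2 * ∑ s ∈ univ.erase (0 : ZMod n), ∑ s' ∈ univ.erase (0 : ZMod n),
        if s • φ w + s' • φ w' = 0 then (n : ℝ) ^ Fintype.card ι else 0 := by
  have h : ((∑ x, planeKernel φ c x w * planeKernel φ c x w' : ℝ) : ℂ) =
      (n : ℂ)⁻¹ ^ 2 * ∑ s ∈ univ.erase (0 : ZMod n), ∑ s' ∈ univ.erase (0 : ZMod n),
        ZMod.stdAddChar (-(s * c w + s' * c w')) *
          ∑ x : ι → ZMod n, ZMod.stdAddChar (x ⬝ᵥ (s • φ w + s' • φ w')) := by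
    have h0 : ∀ x, (planeKernel φ c x w : ℂ) * planeKernel φ c x w' = (n : ℂ)⁻¹ ^ 2 *
        ∑ s ∈ univ.erase (0 : ZMod n), ∑ s' ∈ univ.erase (0 : ZMod n),
          ZMod.stdAddChar (-(s * c w + s' * c w')) *
            ZMod.stdAddChar (x ⬝ᵥ (s • φ w + s' • φ w')) := fun x => by
      rw [planeKernel_eq_sum, planeKernel_eq_sum, mul_mul_mul_comm, ← sq, sum_mul_sum]
      congr 1
      refine sum_congr rfl fun s _ => sum_congr rfl fun s' _ => ?_
      rw [← AddChar.map_add_eq_mul, ← AddChar.map_add_eq_mul, dotProduct_add, dotProduct_smul,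
        dotProduct_smul, smul_eq_mul, smul_eq_mul]
      congr 1
      ring
    push_cast
    simp only [h0]
    rw [← mul_sum, sum_comm]
    congr 1
    refine sum_congr rfl fun s _ => ?_
    rw [sum_comm]
    exact sum_congr rfl fun s' _ => (mul_sum _ _ _).symm
  rw [← Real.norm_eq_abs, ← Complex.norm_real, h, norm_mul, norm_pow, norm_inv, Complex.norm_natCast]
  gcongr
  refine (norm_sum_le _ _).trans (sum_le_sum fun s _ => (norm_sum_le _ _).trans
    (sum_le_sum fun s' _ => ?_))
  rw [norm_mul, AddChar.norm_apply, one_mul, sum_stdAddChar_dotProduct]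
  split_ifs <;> simp

end Characters

section Counting

variable {n : ℕ} [NeZero n]

theorem ZMod.card_mul_eq_le_gcd (s b : ZMod n) : #{u : ZMod n | s * u = b} ≤ Nat.gcd s.val n := by
  have hpos : 0 < Nat.gcd s.val n := Nat.gcd_pos_of_pos_right _ (NeZero.pos n)
  rcases (univ.filter fun u : ZMod n => s * u = b).eq_empty_or_nonempty with h | ⟨u₀, hu₀⟩
  · rw [h]; exact Nat.zero_le _
  rw [mem_filter_univ] at hu₀
  refine le_trans ?_ (IsAddCyclic.card_nsmul_eq_zero_le (α := ZMod n) hpos)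
  refine card_le_card_of_injOn (fun u => u - u₀) (fun u hu => ?_) (sub_left_injective.injOn)
  have hu' : s * u = b := by simpa using hu
  have h0 : s * (u - u₀) = 0 := by rw [mul_sub, hu', hu₀, sub_self]
  simp only [coe_filter, mem_univ, true_and, Set.mem_ofPred_eq, nsmul_eq_mul]
  have hb := congrArg (Int.cast : ℤ → ZMod n) (Nat.gcd_eq_gcd_ab s.val n)
  push_cast at hb
  rw [hb, ZMod.natCast_self, zero_mul, add_zero, ZMod.natCast_val, ZMod.cast_id', id,
    mul_right_comm, h0, zero_mul]

theorem card_smul_eq_le_gcd_pow {ι : Type*} [Fintype ι] [DecidableEq ι] (s : ZMod n)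
    (v : ι → ZMod n) :
    #{w : ι → ZMod n | s • w = v} ≤ Nat.gcd s.val n ^ Fintype.card ι := by
  have h : (univ.filter fun w : ι → ZMod n => s • w = v) =
      Fintype.piFinset fun i => univ.filter fun u => s * u = v i := by
    ext w
    simp [funext_iff]
  rw [h, Fintype.card_piFinset]
  exact (prod_le_prod' fun i _ => ZMod.card_mul_eq_le_gcd s (v i)).trans_eq (by simp)

/-- The number of pairs `(s, w)` with `s ≠ 0`, `w ∈ ℤ_n^d` and `s • w = 0`. -/
def gcdPowSum (n d : ℕ) [NeZero n] : ℕ :=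
  ∑ s ∈ univ.erase (0 : ZMod n), Nat.gcd s.val n ^ d

theorem sum_gcd_le (n : ℕ) [NeZero n] :
    ∑ s : ZMod n, Nat.gcd s.val n ≤ n.divisors.card * n := by
  have hmaps : ∀ s ∈ (univ : Finset (ZMod n)), Nat.gcd s.val n ∈ n.divisors := fun s _ =>
    Nat.mem_divisors.mpr ⟨Nat.gcd_dvd_right _ _, NeZero.ne n⟩
  rw [← sum_fiberwise_of_maps_to hmaps, ← smul_eq_mul]
  refine sum_le_card_nsmul _ _ _ fun g hg => ?_
  obtain ⟨⟨m, rfl⟩, -⟩ := Nat.mem_divisors.mp hg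
  have hg0 : 0 < g := Nat.pos_of_mem_divisors hg
  have hcard : #{s : ZMod (g * m) | Nat.gcd s.val (g * m) = g} ≤ m := by
    refine (card_le_card_of_injOn (t := range m) (fun s => s.val / g) (fun s hs => ?_)
      fun s hs t ht hst => ?_).trans_eq (card_range m)
    · simpa using Nat.div_lt_of_lt_mul (ZMod.val_lt s)
    · have hs' : g ∣ s.val := by
        have : Nat.gcd s.val (g * m) = g := by simpa using hs
        exact this.symm.dvd.trans (Nat.gcd_dvd_left _ _)
      have ht' : g ∣ t.val := by
        have : Nat.gcd t.val (g * m) = g := by simpa using ht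
        exact this.symm.dvd.trans (Nat.gcd_dvd_left _ _)
      exact ZMod.val_injective _ ((Nat.div_left_inj hs' ht').mp hst)
  calc _ = ∑ s ∈ univ.filter (fun s : ZMod (g * m) => Nat.gcd s.val (g * m) = g), g :=
        sum_congr rfl fun s hs => (mem_filter.mp hs).2
    _ = #{s : ZMod (g * m) | Nat.gcd s.val (g * m) = g} * g := by rw [sum_const, smul_eq_mul]
    _ ≤ m * g := by gcongr
    _ = g * m := mul_comm _ _

theorem gcdPowSum_mul_minFac_pow_le (n d : ℕ) [NeZero n] :
    gcdPowSum n (d + 1) * n.minFac ^ d ≤ n.divisors.card * n ^ (d + 1) := by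
  have h : ∀ s ∈ univ.erase (0 : ZMod n), Nat.gcd s.val n * n.minFac ≤ n := by
    intro s hs
    obtain ⟨m, hm⟩ := Nat.gcd_dvd_right s.val n
    have hs0 : s.val ≠ 0 := fun h => (mem_erase.mp hs).1 ((ZMod.val_eq_zero s).mp h)
    have hlt : Nat.gcd s.val n < n :=
      (Nat.le_of_dvd (Nat.pos_of_ne_zero hs0) (Nat.gcd_dvd_left _ _)).trans_lt (ZMod.val_lt s)
    have hm2 : 2 ≤ m := by
      by_contra hm2
      have : m = 0 ∨ m = 1 := by omega
      rcases this with rfl | rfl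
      · exact NeZero.ne n (by simpa using hm)
      · omega
    calc Nat.gcd s.val n * n.minFac ≤ Nat.gcd s.val n * m :=
          Nat.mul_le_mul_left _ (Nat.minFac_le_of_dvd hm2 ⟨_, hm.trans (mul_comm _ _)⟩)
      _ = n := hm.symm
  calc gcdPowSum n (d + 1) * n.minFac ^ d
      = ∑ s ∈ univ.erase (0 : ZMod n), Nat.gcd s.val n * (Nat.gcd s.val n * n.minFac) ^ d := by
        rw [gcdPowSum, sum_mul]
        exact sum_congr rfl fun s _ => by ring
    _ ≤ ∑ s ∈ univ.erase (0 : ZMod n), Nat.gcd s.val n * n ^ d := by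
        gcongr with s hs; exact h s hs
    _ ≤ ∑ s : ZMod n, Nat.gcd s.val n * n ^ d :=
        sum_le_sum_of_subset (erase_subset _ _)
    _ ≤ n.divisors.card * n * n ^ d := by
        rw [← sum_mul]; gcongr; exact sum_gcd_le n
    _ = n.divisors.card * n ^ (d + 1) := by ring

end Counting

section Distances

variable {n d : ℕ}

theorem nrm_sub (x y : Fin d → ZMod n) : nrm (x - y) = nrm x - 2 * (x ⬝ᵥ y) + nrm y := by
  simp only [nrm, dotProduct, mul_sum, ← sum_sub_distrib, ← sum_add_distrib]
  exact sum_congr rfl fun i _ => by simp only [Pi.sub_apply]; ring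

theorem nrm_zero : nrm (0 : Fin d → ZMod n) = 0 := by simp [nrm]

theorem nrm_sub_comm (x y : Fin d → ZMod n) : nrm (x - y) = nrm (y - x) :=
  sum_congr rfl fun i _ => by simp only [Pi.sub_apply]; ring

theorem ZMod.isUnit_two_of_odd (hn : Odd n) : IsUnit (2 : ZMod n) := by
  have := (ZMod.isUnit_iff_coprime 2 n).mpr (Nat.coprime_two_left.mpr hn)
  exact_mod_cast this

/-- The points of `E` equidistant from two given points. -/
def bisector (E : Finset (Fin d → ZMod n)) (y y' : Fin d → ZMod n) : Finset (Fin d → ZMod n) :=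
  E.filter fun x => nrm (y - x) = nrm (y' - x)

variable [NeZero n]

/-- The bound for the squared norm of the incidence kernels attached to distances in `ℤ_n^d`. -/
noncomputable def discrepancy (n d : ℕ) [NeZero n] : ℝ := (n : ℝ)⁻¹ * n ^ d * gcdPowSum n d

theorem discrepancy_nonneg : 0 ≤ discrepancy n d := by unfold discrepancy; positivity

theorem sum_abs_gram_planeKernel_le {ι W : Type*} [Fintype ι] [DecidableEq ι] [Fintype W]
    (φ : W → ι → ZMod n) (c : W → ZMod n) (w : W) :
    ∑ w', |∑ x, planeKernel φ c x w * planeKernel φ c x w'| ≤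
      (n : ℝ)⁻¹ ^ 2 * n ^ Fintype.card ι *
        ∑ s ∈ univ.erase (0 : ZMod n), ∑ s' ∈ univ.erase (0 : ZMod n),
          (#{w' | s • φ w + s' • φ w' = 0} : ℝ) := by
  refine (sum_le_sum fun w' _ => abs_gram_planeKernel_le φ c w w').trans_eq ?_
  rw [← mul_sum, mul_assoc]
  congr 1
  rw [sum_comm, mul_sum]
  refine sum_congr rfl fun s _ => ?_
  rw [sum_comm, mul_sum]
  refine sum_congr rfl fun s' _ => ?_
  rw [← sum_filter, sum_const, nsmul_eq_mul, mul_comm]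

theorem sum_sq_card_bisector_sub_le (hn : Odd n) (E : Finset (Fin d → ZMod n))
    (y : Fin d → ZMod n) :
    ∑ y', ((#(bisector E y y') : ℝ) - #E * (n : ℝ)⁻¹) ^ 2 ≤ discrepancy n d * #E := by
  have hn0 : (n : ℝ) ≠ 0 := by exact_mod_cast NeZero.ne n
  have h2 := ZMod.isUnit_two_of_odd hn
  let φ : (Fin d → ZMod n) → Fin d → ZMod n := fun y' => (2 : ZMod n) • (y' - y)
  let c : (Fin d → ZMod n) → ZMod n := fun y' => nrm y' - nrm y
  have hrow : ∀ w, ∑ w', |∑ x, planeKernel φ c x w * planeKernel φ c x w'| ≤ discrepancy n d := by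
    intro w
    refine (sum_abs_gram_planeKernel_le φ c w).trans ?_
    have hcard : ∀ s s' : ZMod n, #{w' | s • φ w + s' • φ w' = 0} ≤ Nat.gcd s'.val n ^ d := by
      intro s s'
      have h3 := card_smul_eq_le_gcd_pow s' (-(s • (w - y)))
      rw [Fintype.card_fin] at h3
      refine le_trans (card_le_card_of_injOn (fun w' => w' - y) (fun w' hw' => ?_)
        sub_left_injective.injOn) h3
      simp only [coe_filter, mem_univ, true_and, Set.mem_ofPred_eq, φ] at hw' ⊢
      rw [smul_comm s, smul_comm s', ← smul_add, h2.smul_eq_zero] at hw'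
      exact eq_neg_of_add_eq_zero_right hw'
    calc _ ≤ (n : ℝ)⁻¹ ^ 2 * n ^ Fintype.card (Fin d) *
          ∑ s ∈ univ.erase (0 : ZMod n), ∑ s' ∈ univ.erase (0 : ZMod n),
            ((Nat.gcd s'.val n ^ d : ℕ) : ℝ) := by
          gcongr; exact hcard _ _
      _ = (n : ℝ)⁻¹ ^ 2 * n ^ d * (#(univ.erase (0 : ZMod n)) * gcdPowSum n d) := by
          rw [sum_const, nsmul_eq_mul, gcdPowSum, Fintype.card_fin]; push_cast; rfl
      _ ≤ (n : ℝ)⁻¹ ^ 2 * n ^ d * (n * gcdPowSum n d) := by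
          gcongr
          exact (card_erase_le).trans_eq (by simp [ZMod.card])
      _ = discrepancy n d := by unfold discrepancy; field_simp
  have h := sum_sq_le_of_gram_row_le_dual _ discrepancy_nonneg hrow
    (fun x => if x ∈ E then 1 else 0)
  have hiff : ∀ x y', x ⬝ᵥ φ y' = c y' ↔ nrm (y - x) = nrm (y' - x) := by
    intro x y'
    rw [nrm_sub_comm y, nrm_sub_comm y', nrm_sub, nrm_sub]
    simp only [φ, c, dotProduct_smul, dotProduct_sub, smul_eq_mul]
    constructor <;> intro h <;> linear_combination h
  convert h using 2 with y'
  · congr 1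
    simp only [ite_mul, one_mul, zero_mul, sum_ite_mem, univ_inter, planeKernel, hiff,
      sum_sub_distrib, sum_const, nsmul_eq_mul, bisector, sum_boole]
  · simp

theorem sum_card_bisector_le (hn : Odd n) (E : Finset (Fin d → ZMod n)) :
    ∑ y ∈ E, ∑ y' ∈ E, (#(bisector E y y') : ℝ) ≤
      (#E : ℝ) ^ 3 * (n : ℝ)⁻¹ + discrepancy n d * #E := by
  have hn0 : (n : ℝ) ≠ 0 := by exact_mod_cast NeZero.ne n
  have h2 := ZMod.isUnit_two_of_odd hn
  let φ : (Fin d → ZMod n) → Fin (d + 1) → ZMod n := fun y => Matrix.vecCons 1 ((2 : ZMod n) • y)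
  let c : (Fin d → ZMod n) → ZMod n := nrm
  have hrow : ∀ w, ∑ w', |∑ x, planeKernel φ c x w * planeKernel φ c x w'| ≤ discrepancy n d := by
    intro w
    refine (sum_abs_gram_planeKernel_le φ c w).trans ?_
    have hcard : ∀ s s' : ZMod n, #{w' | s • φ w + s' • φ w' = 0} ≤
        if s' = -s then Nat.gcd s.val n ^ d else 0 := by
      intro s s'
      have hφ : ∀ w', s • φ w + s' • φ w' = 0 → s' = -s ∧ s • w' = s • w := by
        intro w' hw'
        simp only [φ, Matrix.smul_cons, Matrix.cons_add_cons, Matrix.cons_eq_zero_iff] at hw'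
        obtain ⟨h3, h4⟩ := hw'
        have h5 : s' = -s := by
          simp only [smul_eq_mul, mul_one] at h3
          exact eq_neg_of_add_eq_zero_right h3
        refine ⟨h5, ?_⟩
        rw [smul_comm s, smul_comm s', ← smul_add, h2.smul_eq_zero, h5, neg_smul,
          add_neg_eq_zero] at h4
        exact h4.symm
      split_ifs with hs
      · have h3 := card_smul_eq_le_gcd_pow s (s • w)
        rw [Fintype.card_fin] at h3
        refine le_trans (card_le_card fun w' hw' => ?_) h3
        rw [mem_filter_univ] at hw' ⊢
        exact (hφ w' hw').2
      · rw [Nat.le_zero, card_eq_zero, filter_eq_empty_iff]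
        exact fun w' _ hw' => hs (hφ w' hw').1
    calc _ ≤ (n : ℝ)⁻¹ ^ 2 * n ^ Fintype.card (Fin (d + 1)) *
          ∑ s ∈ univ.erase (0 : ZMod n), ∑ s' ∈ univ.erase (0 : ZMod n),
            ((if s' = -s then Nat.gcd s.val n ^ d else 0 : ℕ) : ℝ) := by
          gcongr; exact hcard _ _
      _ = (n : ℝ)⁻¹ ^ 2 * n ^ (d + 1) * gcdPowSum n d := by
          rw [gcdPowSum, Fintype.card_fin]
          push_cast
          congr 1
          refine sum_congr rfl fun s hs => ?_
          rw [sum_ite_eq', if_pos (by simpa using hs)]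
      _ = discrepancy n d := by unfold discrepancy; field_simp; ring
  have h := sum_sq_le_of_gram_row_le _ hrow (fun x => if x ∈ E then 1 else 0)
  let ν : (Fin d → ZMod n) → ZMod n → ℝ := fun x t => #{y ∈ E | nrm (y - x) = t}
  have hker : ∀ x t, ∑ w, (if w ∈ E then 1 else 0) *
      planeKernel φ c (Matrix.vecCons (t - nrm x) x) w = ν x t - #E * (n : ℝ)⁻¹ := by
    intro x t
    have hiff : ∀ y, Matrix.vecCons (t - nrm x) x ⬝ᵥ φ y = c y ↔ nrm (y - x) = t := by
      intro y
      rw [nrm_sub_comm, nrm_sub]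
      simp only [φ, c, Matrix.cons_dotProduct_cons, dotProduct_smul, smul_eq_mul]
      constructor <;> intro h <;> linear_combination -h
    simp only [ite_mul, one_mul, zero_mul, sum_ite_mem, univ_inter, planeKernel, hiff,
      sum_sub_distrib, sum_const, nsmul_eq_mul, sum_boole, ν]
  have hvar : ∑ x ∈ E, ∑ t, (ν x t - #E * (n : ℝ)⁻¹) ^ 2 ≤ discrepancy n d * #E := by
    have hinj : Set.InjOn (fun p : (Fin d → ZMod n) × ZMod n => Matrix.vecCons (p.2 - nrm p.1) p.1)
        (E ×ˢ (univ : Finset (ZMod n)) : Finset _) := by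
      rintro ⟨x, t⟩ - ⟨x', t'⟩ - hxx
      have h0 := congrFun hxx 0
      have h1 := congrArg Matrix.vecTail hxx
      simp only [Matrix.tail_cons, Matrix.cons_val_zero] at h0 h1
      subst h1
      simpa using h0
    calc ∑ x ∈ E, ∑ t, (ν x t - #E * (n : ℝ)⁻¹) ^ 2
        = ∑ z ∈ (E ×ˢ (univ : Finset (ZMod n))).image
            (fun p => Matrix.vecCons (p.2 - nrm p.1) p.1),
            (∑ w, (if w ∈ E then 1 else 0) * planeKernel φ c z w) ^ 2 := by
          rw [sum_image hinj, sum_product]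
          simp only [hker]
      _ ≤ ∑ z, (∑ w, (if w ∈ E then 1 else 0) * planeKernel φ c z w) ^ 2 :=
          sum_le_sum_of_subset_of_nonneg (subset_univ _) fun _ _ _ => sq_nonneg _
      _ ≤ discrepancy n d * #E := h.trans_eq (by simp)
  have hν1 : ∀ x, ∑ t, ν x t = #E := by
    intro x
    have := card_eq_sum_card_fiberwise (s := E) (t := univ) (f := fun y => nrm (y - x))
      (fun _ _ => mem_univ _)
    simp only [ν]
    exact_mod_cast this.symm
  have hν2 : ∀ x, ∑ t, ν x t ^ 2 =
      ∑ y ∈ E, ∑ y' ∈ E, if nrm (y - x) = nrm (y' - x) then (1 : ℝ) else 0 := by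
    intro x
    have : ∀ t, ν x t ^ 2 = ∑ y ∈ E, ∑ y' ∈ E,
        if nrm (y - x) = t then if nrm (y' - x) = t then (1 : ℝ) else 0 else 0 := by
      intro t
      simp only [ν, ← sum_boole, sq, sum_mul_sum, ite_mul, one_mul, zero_mul]
    simp only [this]
    rw [sum_comm]
    refine sum_congr rfl fun y _ => ?_
    rw [sum_comm]
    refine sum_congr rfl fun y' _ => ?_
    rw [sum_ite_eq, if_pos (mem_univ _)]
    simp only [eq_comm]
  have hexp : ∀ x, ∑ t, (ν x t - #E * (n : ℝ)⁻¹) ^ 2 = ∑ t, ν x t ^ 2 - (#E : ℝ) ^ 2 * (n : ℝ)⁻¹ := by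
    intro x
    have : ∀ t, (ν x t - #E * (n : ℝ)⁻¹) ^ 2 =
        ν x t ^ 2 - 2 * #E * (n : ℝ)⁻¹ * ν x t + (#E : ℝ) ^ 2 * (n : ℝ)⁻¹ ^ 2 := fun t => by ring
    simp only [this, sum_add_distrib, sum_sub_distrib, ← mul_sum, hν1, sum_const, card_univ,
      ZMod.card, nsmul_eq_mul]
    field_simp
    ring
  have hswap : ∑ y ∈ E, ∑ y' ∈ E, (#(bisector E y y') : ℝ) = ∑ x ∈ E, ∑ t, ν x t ^ 2 := by
    simp only [hν2, bisector, ← sum_boole]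
    exact (sum_congr rfl fun y _ => sum_comm).trans sum_comm
  rw [hswap]
  simp only [hexp, sum_sub_distrib, sum_const, nsmul_eq_mul] at hvar
  linarith

end Distances

section Combinatorics

variable {α β γ : Type*} [DecidableEq β] [DecidableEq γ]

theorem card_sq_le_card_image_mul_card_filter (Y : Finset α) (f : α → β) :
    #Y ^ 2 ≤ #(Y.image f) * #{p ∈ Y ×ˢ Y | f p.1 = f p.2} := by
  have h1 : #{p ∈ Y ×ˢ Y | f p.1 = f p.2} = ∑ b ∈ Y.image f, #{y ∈ Y | f y = b} ^ 2 := by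
    rw [card_eq_sum_card_fiberwise (t := Y.image f) (f := fun p => f p.1)]
    · refine sum_congr rfl fun b _ => ?_
      rw [sq, ← card_product]
      congr 1
      ext ⟨p, q⟩
      simp only [mem_filter, mem_product]
      constructor
      · rintro ⟨⟨⟨hp, hq⟩, hpq⟩, hb⟩
        exact ⟨⟨hp, hb⟩, hq, hpq ▸ hb⟩
      · rintro ⟨⟨hp, hb⟩, hq, hb'⟩
        exact ⟨⟨⟨hp, hq⟩, hb.trans hb'.symm⟩, hb⟩
    · intro p hp
      simp only [coe_filter, mem_product, Set.mem_ofPred_eq] at hp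
      exact mem_coe.mpr (mem_image_of_mem f hp.1.1)
  rw [h1, card_eq_sum_card_image f Y]
  exact sq_sum_le_card_mul_sum_sq

theorem card_image_mul_le_card (G : Finset α) (τ : α → β) (S : α → Finset γ) (T : Finset (β × γ))
    {s : ℝ} (hs : ∀ x ∈ G, s ≤ #(S x)) (hT : ∀ x ∈ G, ∀ b ∈ S x, (τ x, b) ∈ T) :
    #(G.image τ) * s ≤ #T := by
  have h1 : ∑ a ∈ G.image τ, #{p ∈ T | p.1 = a} ≤ #T := by
    have h2 := card_eq_sum_card_fiberwise (s := T.filter fun p => p.1 ∈ G.image τ) (f := Prod.fst)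
      (t := G.image τ) fun p hp => (mem_filter.mp hp).2
    refine le_trans (sum_le_sum fun a ha => card_le_card fun p hp => ?_)
      (h2.symm.le.trans (card_filter_le _ _))
    obtain ⟨hp, hpa⟩ := mem_filter.mp hp
    exact mem_filter.mpr ⟨mem_filter.mpr ⟨hp, hpa ▸ ha⟩, hpa⟩
  calc #(G.image τ) * s = ∑ a ∈ G.image τ, s := by rw [sum_const, nsmul_eq_mul]
    _ ≤ ∑ a ∈ G.image τ, (#{p ∈ T | p.1 = a} : ℝ) := by
      refine sum_le_sum fun a ha => ?_
      obtain ⟨x, hx, rfl⟩ := mem_image.mp ha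
      refine (hs x hx).trans ?_
      rw [← card_image_of_injective (S x) (Prod.mk_right_injective (τ x))]
      refine Nat.cast_le.mpr (card_le_card fun p hp => ?_)
      obtain ⟨b, hb, rfl⟩ := mem_image.mp hp
      exact mem_filter.mpr ⟨hT x hx b hb, rfl⟩
    _ ≤ #T := by exact_mod_cast h1

end Combinatorics

section Simplices

variable {n d : ℕ}

/-- The pairs in `E` that are at the same distances from each of the points `x i`. -/
def starPairs {m : ℕ} (E : Finset (Fin d → ZMod n)) (x : Fin m → Fin d → ZMod n) :
    Finset ((Fin d → ZMod n) × (Fin d → ZMod n)) :=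
  (E ×ˢ E).filter fun p => (fun i => nrm (p.1 - x i)) = fun i => nrm (p.2 - x i)

/-- The matrix of pairwise distances of a tuple of points. -/
def distMatrix {m : ℕ} (x : Fin m → Fin d → ZMod n) : Fin m → Fin m → ZMod n :=
  fun i j => nrm (x i - x j)

theorem sum_card_starPairs (m : ℕ) (E : Finset (Fin d → ZMod n)) :
    ∑ x ∈ Fintype.piFinset (fun _ : Fin m => E), #(starPairs E x) =
      ∑ y ∈ E, ∑ y' ∈ E, #(bisector E y y') ^ m := by
  simp only [starPairs, card_filter]
  rw [sum_comm, sum_product]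
  refine sum_congr rfl fun y _ => sum_congr rfl fun y' _ => ?_
  rw [← card_filter]
  have h : (Fintype.piFinset (fun _ : Fin m => E)).filter
      (fun x => (fun i => nrm (y - x i)) = fun i => nrm (y' - x i)) =
      Fintype.piFinset fun _ : Fin m => bisector E y y' := by
    ext x
    simp [bisector, funext_iff, forall_and]
  rw [h, Fintype.card_piFinset]
  simp

/-- The distance matrix is determined by its entries above the diagonal. -/
theorem card_image_distMatrix_le {m : ℕ} (S : Finset (Fin m → Fin d → ZMod n)) :
    #(S.image distMatrix) ≤ #(S.image fun x => fun p : {p : Fin m × Fin m // p.1 < p.2} =>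
      nrm (x p.1.1 - x p.1.2)) := by
  let symmetrize : ({p : Fin m × Fin m // p.1 < p.2} → ZMod n) → Fin m → Fin m → ZMod n :=
    fun t i j => if h : i < j then t ⟨(i, j), h⟩ else if h : j < i then t ⟨(j, i), h⟩ else 0
  refine le_trans (le_of_eq ?_) (card_image_le (f := symmetrize))
  rw [image_image]
  congr 1
  refine image_congr fun x _ => ?_
  ext i j
  simp only [symmetrize, distMatrix, Function.comp_apply]
  split_ifs with h1 h2
  · rfl
  · exact nrm_sub_comm _ _
  · rw [le_antisymm (not_lt.mp h2) (not_lt.mp h1), sub_self, nrm_zero]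

variable [NeZero n]

theorem sum_card_bisector_pow_le (hn : Odd n) (E : Finset (Fin d → ZMod n)) {m : ℕ} (hm : m ≠ 0)
    (hE : discrepancy n d ≤ (#E : ℝ) ^ 2 * (n : ℝ)⁻¹ ^ m) :
    ∑ y ∈ E, ∑ y' ∈ E, (#(bisector E y y') : ℝ) ^ m ≤
      2 ^ m * (#E : ℝ) ^ (m + 2) * (n : ℝ)⁻¹ ^ m := by
  set e : ℝ := (#E : ℝ)
  set u : ℝ := (n : ℝ)⁻¹
  have he0 : 0 ≤ e := Nat.cast_nonneg _
  have hu0 : 0 ≤ u := by positivity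
  have hu1 : u ≤ 1 := inv_le_one_of_one_le₀ (by exact_mod_cast NeZero.one_le)
  obtain rfl | ⟨m, rfl⟩ : m = 1 ∨ ∃ r, m = r + 2 := by
    rcases m with _ | _ | m
    · exact absurd rfl hm
    · exact Or.inl rfl
    · exact Or.inr ⟨m, rfl⟩
  · have h := sum_card_bisector_le hn E
    simp only [pow_one] at hE ⊢
    refine h.trans ?_
    calc e ^ 3 * u + discrepancy n d * e ≤ e ^ 3 * u + (e ^ 2 * u) * e := by gcongr
      _ = _ := by ring
  · have hR : ∀ y y', |(#(bisector E y y') : ℝ) - e * u| ≤ e := by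
      intro y y'
      have h1 : (#(bisector E y y') : ℝ) ≤ e := Nat.cast_le.mpr (card_filter_le _ _)
      have h2 : (0 : ℝ) ≤ #(bisector E y y') := Nat.cast_nonneg _
      have h3 : e * u ≤ e := mul_le_of_le_one_right he0 hu1
      have h4 : 0 ≤ e * u := by positivity
      rw [abs_le]
      constructor <;> linarith
    have hpt : ∀ y y', (#(bisector E y y') : ℝ) ^ (m + 2) ≤
        2 ^ (m + 1) * ((e * u) ^ (m + 2) + e ^ m * (#(bisector E y y') - e * u) ^ 2) := by
      intro y y'
      set N : ℝ := (#(bisector E y y') : ℝ)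
      calc N ^ (m + 2) ≤ (e * u + |N - e * u|) ^ (m + 2) := by
            gcongr
            linarith [le_abs_self (N - e * u)]
        _ ≤ 2 ^ (m + 1) * ((e * u) ^ (m + 2) + |N - e * u| ^ (m + 2)) :=
            add_pow_le (by positivity) (abs_nonneg _) _
        _ ≤ _ := by
            rw [pow_add |N - e * u|, sq_abs]
            gcongr
            exact hR y y'
    have hvar : ∑ y ∈ E, ∑ y' ∈ E, ((#(bisector E y y') : ℝ) - e * u) ^ 2 ≤
        e * (discrepancy n d * e) := by
      calc _ ≤ ∑ y ∈ E, discrepancy n d * e := by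
            refine sum_le_sum fun y _ => le_trans ?_ (sum_sq_card_bisector_sub_le hn E y)
            exact sum_le_sum_of_subset_of_nonneg (subset_univ _) fun _ _ _ => sq_nonneg _
        _ = _ := by rw [sum_const, nsmul_eq_mul]
    calc _ ≤ ∑ y ∈ E, ∑ y' ∈ E,
          2 ^ (m + 1) * ((e * u) ^ (m + 2) + e ^ m * ((#(bisector E y y') : ℝ) - e * u) ^ 2) :=
          sum_le_sum fun y _ => sum_le_sum fun y' _ => hpt y y'
      _ = 2 ^ (m + 1) * (e * (e * (e * u) ^ (m + 2)) +
          e ^ m * ∑ y ∈ E, ∑ y' ∈ E, ((#(bisector E y y') : ℝ) - e * u) ^ 2) := by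
          simp only [← mul_sum, sum_add_distrib, sum_const, nsmul_eq_mul]
          rfl
      _ ≤ 2 ^ (m + 1) * (e * (e * (e * u) ^ (m + 2)) +
          e ^ m * (e * ((e ^ 2 * u ^ (m + 2)) * e))) := by
          gcongr
          exact hvar.trans (by gcongr)
      _ = _ := by ring

/-- Many `m`-tuples in `E` have both a large fibre in `𝓔` and few equidistant pairs. -/
theorem exists_large_good_tuples (hn : Odd n) (E : Finset (Fin d → ZMod n)) {m : ℕ} (hm : m ≠ 0)
    (hE : discrepancy n d ≤ (#E : ℝ) ^ 2 * (n : ℝ)⁻¹ ^ m) (hE0 : E.Nonempty) {c : ℝ} (hc : 0 < c)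
    (𝓔 : Finset (Fin (m + 1) → Fin d → ZMod n)) (hsub : 𝓔 ⊆ Fintype.piFinset fun _ => E)
    (hcard : c * (#E : ℝ) ^ (m + 1) ≤ #𝓔) :
    ∃ G ⊆ Fintype.piFinset (fun _ : Fin m => E), c / 4 * (#E : ℝ) ^ m ≤ #G ∧ ∀ x ∈ G,
      c / 2 * #E ≤ (#{y ∈ E | (Fin.cons y x : Fin (m + 1) → Fin d → ZMod n) ∈ 𝓔} : ℝ) ∧
      (#(starPairs E x) : ℝ) ≤ 2 ^ (m + 2) / c * (#E : ℝ) ^ 2 * (n : ℝ)⁻¹ ^ m := by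
  have he0 : (0 : ℝ) < #E := Nat.cast_pos.mpr hE0.card_pos
  have hu0 : 0 < (n : ℝ)⁻¹ := inv_pos.mpr (Nat.cast_pos.mpr (NeZero.pos n))
  set e : ℝ := (#E : ℝ)
  set u : ℝ := (n : ℝ)⁻¹
  set P := Fintype.piFinset (fun _ : Fin m => E)
  let Y : (Fin m → Fin d → ZMod n) → Finset (Fin d → ZMod n) := fun x =>
    E.filter fun y => (Fin.cons y x : Fin (m + 1) → Fin d → ZMod n) ∈ 𝓔
  let G := P.filter fun x => c / 2 * e ≤ (#(Y x) : ℝ) ∧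
    (#(starPairs E x) : ℝ) ≤ 2 ^ (m + 2) / c * e ^ 2 * u ^ m
  refine ⟨G, filter_subset _ _, ?_, fun x hx => (mem_filter.mp hx).2⟩
  have hPcard : (#P : ℝ) = e ^ m := by simp [P, e]
  have hfib : (#𝓔 : ℝ) ≤ ∑ x ∈ P, (#(Y x) : ℝ) := by
    rw [card_eq_sum_card_fiberwise (s := 𝓔) (t := P)
      (f := fun z : Fin (m + 1) → Fin d → ZMod n => (Fin.tail z : Fin m → Fin d → ZMod n))
      fun z hz => mem_coe.mpr (Fintype.mem_piFinset.mpr fun i =>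
        Fintype.mem_piFinset.mp (hsub hz) i.succ)]
    push_cast
    refine sum_le_sum fun x _ => Nat.cast_le.mpr ?_
    refine card_le_card_of_injOn (fun z => z 0) (fun z hz => ?_) fun z hz z' hz' h => ?_
    · obtain ⟨hz𝓔, rfl⟩ := mem_filter.mp hz
      refine mem_coe.mpr (mem_filter.mpr ⟨Fintype.mem_piFinset.mp (hsub hz𝓔) 0, ?_⟩)
      rwa [Fin.cons_self_tail]
    · rw [← Fin.cons_self_tail z, ← Fin.cons_self_tail z', (mem_filter.mp hz).2,
        (mem_filter.mp hz').2]
      simp only at h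
      rw [h]
  have hD : ∑ x ∈ P, (#(starPairs E x) : ℝ) ≤ 2 ^ m * e ^ (m + 2) * u ^ m := by
    have h := sum_card_bisector_pow_le hn E hm hE
    have h' := sum_card_starPairs m E
    calc ∑ x ∈ P, (#(starPairs E x) : ℝ) = ∑ y ∈ E, ∑ y' ∈ E, (#(bisector E y y') : ℝ) ^ m := by
          exact_mod_cast h'
      _ ≤ _ := h
  have hpt : ∀ x ∈ P, (#(Y x) : ℝ) ≤ (if x ∈ G then e else 0) + c / 2 * e +
      c / (2 ^ (m + 2) * e * u ^ m) * #(starPairs E x) := by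
    intro x hx
    have hYe : (#(Y x) : ℝ) ≤ e := Nat.cast_le.mpr (card_filter_le _ _)
    have hD0 : 0 ≤ c / (2 ^ (m + 2) * e * u ^ m) * (#(starPairs E x) : ℝ) := by positivity
    have hce : 0 < c / 2 * e := by positivity
    by_cases hG : x ∈ G
    · rw [if_pos hG]; linarith
    rw [if_neg hG]
    by_cases hY : c / 2 * e ≤ (#(Y x) : ℝ)
    · have hlt : 2 ^ (m + 2) / c * e ^ 2 * u ^ m < (#(starPairs E x) : ℝ) := by
        by_contra! hle
        exact hG (mem_filter.mpr ⟨hx, hY, hle⟩)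
      have : e ≤ c / (2 ^ (m + 2) * e * u ^ m) * (#(starPairs E x) : ℝ) := by
        calc e = c / (2 ^ (m + 2) * e * u ^ m) * (2 ^ (m + 2) / c * e ^ 2 * u ^ m) := by
              field_simp
          _ ≤ _ := by gcongr
      linarith
    · linarith
  have hsum : c * e ^ (m + 1) ≤ #G * e + c / 2 * e ^ (m + 1) + c / 4 * e ^ (m + 1) := by
    calc c * e ^ (m + 1) ≤ ∑ x ∈ P, (#(Y x) : ℝ) := hcard.trans hfib
      _ ≤ ∑ x ∈ P, ((if x ∈ G then e else 0) + c / 2 * e +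
          c / (2 ^ (m + 2) * e * u ^ m) * #(starPairs E x)) := sum_le_sum hpt
      _ = #G * e + e ^ m * (c / 2 * e) +
          c / (2 ^ (m + 2) * e * u ^ m) * ∑ x ∈ P, (#(starPairs E x) : ℝ) := by
          rw [sum_add_distrib, sum_add_distrib, sum_ite_mem, inter_eq_right.mpr (filter_subset _ _),
            sum_const, sum_const, nsmul_eq_mul, nsmul_eq_mul, hPcard, mul_sum]
      _ ≤ #G * e + e ^ m * (c / 2 * e) +
          c / (2 ^ (m + 2) * e * u ^ m) * (2 ^ m * e ^ (m + 2) * u ^ m) := by gcongr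
      _ = _ := by field_simp; ring
  have : c / 4 * e ^ m * e ≤ #G * e := by
    have : e ^ (m + 1) = e ^ m * e := pow_succ _ _
    rw [this] at hsum
    linarith
  exact le_of_mul_le_mul_right this he0

theorem exists_card_image_distMatrix_ge (k : ℕ) : ∀ c > (0 : ℝ), ∃ c' > (0 : ℝ),
    ∀ (n d : ℕ) [NeZero n], Odd n → ∀ E : Finset (Fin d → ZMod n), E.Nonempty →
      discrepancy n d ≤ (#E : ℝ) ^ 2 * (n : ℝ)⁻¹ ^ k →
      ∀ 𝓔 ⊆ Fintype.piFinset (fun _ : Fin (k + 1) => E), c * (#E : ℝ) ^ (k + 1) ≤ #𝓔 →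
        c' * (n : ℝ) ^ (k * (k + 1) / 2) ≤ #(𝓔.image distMatrix) := by
  induction k with
  | zero =>
    refine fun c hc => ⟨1, one_pos, fun n d _ _ E hE _ 𝓔 _ hcard => ?_⟩
    have he0 : (0 : ℝ) < #E := Nat.cast_pos.mpr hE.card_pos
    have h : 0 < #𝓔 := by
      have : (0 : ℝ) < #𝓔 := lt_of_lt_of_le (by positivity) hcard
      exact_mod_cast this
    have h1 : 1 ≤ #(𝓔.image distMatrix) := ((card_pos.mp h).image _).card_pos
    simpa using h1
  | succ k ih =>
    intro c hc
    obtain ⟨c₁, hc₁, ih⟩ := ih (c / 4) (by positivity)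
    refine ⟨c₁ * (c ^ 3 / 2 ^ (k + 5)), by positivity, fun n d _ hn E hE hA 𝓔 hsub hcard => ?_⟩
    have hn0 : (0 : ℝ) < n := Nat.cast_pos.mpr (NeZero.pos n)
    have he0 : (0 : ℝ) < #E := Nat.cast_pos.mpr hE.card_pos
    obtain ⟨G, hGsub, hGcard, hG⟩ :=
      exists_large_good_tuples hn E k.succ_ne_zero hA hE hc 𝓔 hsub hcard
    have hA' : discrepancy n d ≤ (#E : ℝ) ^ 2 * (n : ℝ)⁻¹ ^ k := by
      refine hA.trans ?_
      gcongr ?_ * ?_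
      exact pow_le_pow_of_le_one (by positivity)
        (inv_le_one_of_one_le₀ (by exact_mod_cast NeZero.one_le)) k.le_succ
    have hbase := ih n d hn E hE hA' G hGsub hGcard
    let star : (Fin (k + 1) → Fin d → ZMod n) → (Fin d → ZMod n) → Fin (k + 1) → ZMod n :=
      fun x y i => nrm (y - x i)
    let Y : (Fin (k + 1) → Fin d → ZMod n) → Finset (Fin d → ZMod n) := fun x =>
      E.filter fun y => (Fin.cons y x : Fin (k + 1 + 1) → Fin d → ZMod n) ∈ 𝓔
    let split : (Fin (k + 1 + 1) → Fin (k + 1 + 1) → ZMod n) →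
        (Fin (k + 1) → Fin (k + 1) → ZMod n) × (Fin (k + 1) → ZMod n) :=
      fun M => (fun i j => M i.succ j.succ, fun i => M 0 i.succ)
    have hstar : ∀ x ∈ G, c ^ 3 / 2 ^ (k + 5) * (n : ℝ) ^ (k + 1) ≤ #((Y x).image (star x)) := by
      intro x hx
      obtain ⟨hY, hD⟩ := hG x hx
      have h1 := card_sq_le_card_image_mul_card_filter (Y x) (star x)
      have h2 : #{p ∈ Y x ×ˢ Y x | star x p.1 = star x p.2} ≤ #(starPairs E x) :=
        card_le_card (filter_subset_filter _
          (product_subset_product (filter_subset _ _) (filter_subset _ _)))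
      have h3 : ((#(Y x) : ℝ)) ^ 2 ≤ #((Y x).image (star x)) * #(starPairs E x) := by
        exact_mod_cast h1.trans (Nat.mul_le_mul_left _ h2)
      have h4 : (c / 2 * #E) ^ 2 ≤
          #((Y x).image (star x)) * (2 ^ (k + 1 + 2) / c * (#E : ℝ) ^ 2 * (n : ℝ)⁻¹ ^ (k + 1)) := by
        calc (c / 2 * #E) ^ 2 ≤ ((#(Y x) : ℝ)) ^ 2 := by gcongr
          _ ≤ _ := h3.trans (by gcongr)
      set B : ℝ := 2 ^ (k + 1 + 2) / c * (#E : ℝ) ^ 2 * (n : ℝ)⁻¹ ^ (k + 1) with hB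
      have hB0 : 0 < B := by positivity
      refine le_of_mul_le_mul_right ?_ hB0
      refine le_trans (le_of_eq ?_) h4
      rw [hB, inv_pow]
      field_simp
      ring
    have hT := card_image_mul_le_card G distMatrix (fun x => (Y x).image (star x))
      ((𝓔.image distMatrix).image split) hstar (by
        intro x _ b hb
        obtain ⟨y, hy, rfl⟩ := mem_image.mp hb
        rw [image_image]
        exact mem_image.mpr ⟨Fin.cons y x, (mem_filter.mp hy).2, rfl⟩)
    have hexp : (k + 1) * (k + 1 + 1) / 2 = k * (k + 1) / 2 + (k + 1) := by
      rw [← Nat.add_mul_div_left _ _ two_pos]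
      congr 1
      ring
    calc c₁ * (c ^ 3 / 2 ^ (k + 5)) * (n : ℝ) ^ ((k + 1) * (k + 1 + 1) / 2)
        = (c₁ * (n : ℝ) ^ (k * (k + 1) / 2)) * (c ^ 3 / 2 ^ (k + 5) * (n : ℝ) ^ (k + 1)) := by
          rw [hexp, pow_add]; ring
      _ ≤ #(G.image distMatrix) * (c ^ 3 / 2 ^ (k + 5) * (n : ℝ) ^ (k + 1)) := by gcongr
      _ ≤ #((𝓔.image distMatrix).image split) := hT
      _ ≤ #(𝓔.image distMatrix) := Nat.cast_le.mpr card_image_le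

theorem discrepancy_le_of_card_ge {k : ℕ} (hd : 1 ≤ d) {e : ℝ}
    (he : e ≥ 1 * Real.sqrt (n.divisors.card) * (n : ℝ) ^ ((d : ℝ) + ((k : ℝ) - 1) / 2) /
      (n.minFac : ℝ) ^ (((d : ℝ) - 1) / 2)) :
    discrepancy n d ≤ e ^ 2 * (n : ℝ)⁻¹ ^ k := by
  obtain ⟨d, rfl⟩ := Nat.exists_eq_add_of_le' hd
  have hn0 : (0 : ℝ) < n := Nat.cast_pos.mpr (NeZero.pos n)
  have hg0 : (0 : ℝ) < n.minFac := Nat.cast_pos.mpr n.minFac_pos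
  have hsq : (1 * Real.sqrt (n.divisors.card) *
      (n : ℝ) ^ (((d + 1 : ℕ) : ℝ) + ((k : ℝ) - 1) / 2) /
      (n.minFac : ℝ) ^ ((((d + 1 : ℕ) : ℝ) - 1) / 2)) ^ 2 =
      n.divisors.card * (n : ℝ) ^ (2 * d + 1 + k) / (n.minFac : ℝ) ^ d := by
    rw [one_mul, div_pow, mul_pow, Real.sq_sqrt (Nat.cast_nonneg _), ← Real.rpow_mul_natCast hn0.le,
      ← Real.rpow_mul_natCast hg0.le, ← Real.rpow_natCast, ← Real.rpow_natCast]
    congr 3 <;> push_cast <;> ring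
  have h1 : (n.divisors.card : ℝ) * (n : ℝ) ^ (2 * d + 1 + k) / (n.minFac : ℝ) ^ d ≤ e ^ 2 := by
    rw [← hsq]
    gcongr
  have h2 : (gcdPowSum n (d + 1) : ℝ) * n.minFac ^ d ≤ n.divisors.card * n ^ (d + 1) := by
    exact_mod_cast gcdPowSum_mul_minFac_pow_le n d
  calc discrepancy n (d + 1) = (n : ℝ) ^ d * gcdPowSum n (d + 1) := by
        unfold discrepancy; field_simp; ring
    _ ≤ (n : ℝ) ^ d * (n.divisors.card * n ^ (d + 1) / n.minFac ^ d) := by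
        gcongr
        rwa [le_div_iff₀ (by positivity)]
    _ = (n.divisors.card * (n : ℝ) ^ (2 * d + 1 + k) / (n.minFac : ℝ) ^ d) * (n : ℝ)⁻¹ ^ k := by
        rw [inv_pow]
        field_simp
        ring
    _ ≤ e ^ 2 * (n : ℝ)⁻¹ ^ k := by gcongr

end Simplices

theorem stmt13 (k d : ℕ) (hk : 1 ≤ k) (hkd : k ≤ d) :
    ∃ C > (0 : ℝ), ∃ c > (0 : ℝ), ∀ (n : ℕ) [NeZero n], Odd n → 3 ≤ n →
      ∀ E : Finset (Fin d → ZMod n),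
      (E.card : ℝ) ≥ C * Real.sqrt (n.divisors.card) *
          (n : ℝ) ^ ((d : ℝ) + ((k : ℝ) - 1) / 2) /
          (n.minFac : ℝ) ^ (((d : ℝ) - 1) / 2) →
      ((((Fintype.piFinset (fun _ : Fin (k + 1) => E)).image
          (fun x => fun p : {p : Fin (k + 1) × Fin (k + 1) // p.1 < p.2} =>
            nrm (x p.1.1 - x p.1.2))).card : ℝ))
        ≥ c * (n : ℝ) ^ (k * (k + 1) / 2) := by
  obtain ⟨c, hc, h⟩ := exists_card_image_distMatrix_ge k 1 one_pos
  refine ⟨1, one_pos, c, hc, fun n _ hn _ E hcard => ?_⟩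
  have hE : E.Nonempty := by
    have hn0 : (0 : ℝ) < n := Nat.cast_pos.mpr (NeZero.pos n)
    have hg0 : (0 : ℝ) < n.minFac := Nat.cast_pos.mpr n.minFac_pos
    have hτ : (0 : ℝ) < n.divisors.card :=
      Nat.cast_pos.mpr (card_pos.mpr (Nat.nonempty_divisors.mpr (NeZero.ne n)))
    have : (0 : ℝ) < E.card := lt_of_lt_of_le (by positivity) hcard
    exact card_pos.mp (by exact_mod_cast this)
  have hmain := h n d hn E hE (discrepancy_le_of_card_ge (hk.trans hkd) hcard) _ subset_rfl
    (by simp)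
  exact hmain.trans (Nat.cast_le.mpr (card_image_distMatrix_le _))
end
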